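/- Assume moreover that X is a unit of B. Then for all integers i, j ∈ ℤ, ρ(X^i ⊗ X^j) · (X ⊗ 1 − 1 ⊗ X) = (X^i ⊗ X^j − X^j ⊗ X^i) · β, where X^i denotes the integer power of the unit X. (This is the division-free form of the identity ρ(X^i ⊗ X^j) = ∂(X^i ⊗ X^j)·β extended to all integer exponents.) -/

import Mathlib

open scoped TensorProduct

theorem twisted_subgroup_aux {T : Type*} [Ring T] (s : T →* T) (ρ : T → T) (d β : T)
    (hL : ∀ x y : T, ρ (x * y) = s x * ρ y + ρ x * y) :
    ∃ H : Subgroup Tˣ, ∀ x : Tˣ, x ∈ H ↔ (ρ x * d = ((x : T) - s x) * β ∧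
      Commute (x : T) d ∧ Commute (x : T) β) := by
  have h1 : ρ 1 = 0 := by
    have := hL 1 1
    simpa using this
  refine ⟨{ carrier := {x : Tˣ | ρ x * d = ((x : T) - s x) * β ∧
              Commute (x : T) d ∧ Commute (x : T) β}
            one_mem' := ?_, mul_mem' := ?_, inv_mem' := ?_ }, fun x => Iff.rfl⟩
  · rintro w v ⟨hw, hwd, hwb⟩ ⟨hv, hvd, hvb⟩
    refine ⟨?_, ?_, ?_⟩
    · calc ρ ((w * v : Tˣ) : T) * d = s w * (ρ v * d) + ρ w * (v * d) := by
            rw [Units.val_mul, hL]; noncomm_ring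
        _ = s w * (((v : T) - s v) * β) + ρ w * d * v := by rw [hv, hvd.eq, mul_assoc]
        _ = s w * (((v : T) - s v) * β) + ((w : T) - s w) * (v * β) := by
            rw [hw, hvb.eq, mul_assoc]
        _ = _ := by rw [Units.val_mul, map_mul]; noncomm_ring
    · rw [Units.val_mul]; exact hwd.mul_left hvd
    · rw [Units.val_mul]; exact hwb.mul_left hvb
  · exact ⟨by simp [h1], by simp, by simp⟩
  · rintro w ⟨hw, hwd, hwb⟩
    have hd := hwd.units_inv_left
    have hb := hwb.units_inv_left
    refine ⟨?_, hd, hb⟩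
    have e1 : s ((w⁻¹ : Tˣ) : T) * s w = 1 := by rw [← map_mul]; simp
    have e0 := hL w ((w⁻¹ : Tˣ) : T)
    rw [Units.mul_inv, h1] at e0
    have e2 : ρ ((w⁻¹ : Tˣ) : T) = - (s ((w⁻¹ : Tˣ) : T) * (ρ w * ((w⁻¹ : Tˣ) : T))) := by
      have : s w * ρ ((w⁻¹ : Tˣ) : T) = - (ρ w * ((w⁻¹ : Tˣ) : T)) :=
        eq_neg_of_add_eq_zero_left e0.symm
      rw [← mul_neg, ← this, ← mul_assoc, e1, one_mul]
    calc ρ ((w⁻¹ : Tˣ) : T) * d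
        = - (s ((w⁻¹ : Tˣ) : T) * (ρ w * (((w⁻¹ : Tˣ) : T) * d))) := by
          rw [e2]; noncomm_ring
      _ = - (s ((w⁻¹ : Tˣ) : T) * (ρ w * d * ((w⁻¹ : Tˣ) : T))) := by rw [hd.eq, mul_assoc]
      _ = - (s ((w⁻¹ : Tˣ) : T) * (((w : T) - s w) * (((w⁻¹ : Tˣ) : T) * β))) := by
          rw [hw, hb.eq, mul_assoc]
      _ = - (s ((w⁻¹ : Tˣ) : T) * ((w : T) * ((w⁻¹ : Tˣ) : T)) * β
            - (s ((w⁻¹ : Tˣ) : T) * s w) * (((w⁻¹ : Tˣ) : T) * β)) := by noncomm_ring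
      _ = _ := by rw [e1, Units.mul_inv]; noncomm_ring

/-- In the Demazure-operator setting for a twisted derivation `ρ` on
`B ⊗[K] B`, assume moreover that `X` is a unit of `B` (witnessed by `u : Bˣ` with
`↑u = X`).  Then for all integers `i, j ∈ ℤ`,
`ρ (Xⁱ ⊗ Xʲ) · (X ⊗ 1 − 1 ⊗ X) = (Xⁱ ⊗ Xʲ − Xʲ ⊗ Xⁱ) · β`,
the division-free form of `ρ (Xⁱ ⊗ Xʲ) = ∂(Xⁱ ⊗ Xʲ)·β` for integer exponents. -/
theorem rho_zpow_mul_eq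
    {K B : Type*} [CommRing K] [Ring B] [Algebra K B] (X : B)
    (ρ : B ⊗[K] B →ₗ[K] B ⊗[K] B)
    (hLeib : ∀ u v : B ⊗[K] B,
      ρ (u * v) = (TensorProduct.comm K B B) u * ρ v + ρ u * v)
    (hc1 : Commute (ρ (X ⊗ₜ[K] 1)) (X ⊗ₜ[K] 1))
    (hc2 : Commute (ρ (X ⊗ₜ[K] 1)) ((1 : B) ⊗ₜ[K] X))
    (hc3 : Commute (ρ ((1 : B) ⊗ₜ[K] X)) (X ⊗ₜ[K] 1))
    (hc4 : Commute (ρ ((1 : B) ⊗ₜ[K] X)) ((1 : B) ⊗ₜ[K] X))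
    (hregL : ∀ u : B ⊗[K] B, (X ⊗ₜ[K] 1 - (1 : B) ⊗ₜ[K] X) * u = 0 → u = 0)
    (hregR : ∀ u : B ⊗[K] B, u * (X ⊗ₜ[K] 1 - (1 : B) ⊗ₜ[K] X) = 0 → u = 0)
    (u : Bˣ) (hu : (u : B) = X) :
    ∀ i j : ℤ,
      ρ (((u ^ i : Bˣ) : B) ⊗ₜ[K] ((u ^ j : Bˣ) : B)) * (X ⊗ₜ[K] 1 - (1 : B) ⊗ₜ[K] X) =
        (((u ^ i : Bˣ) : B) ⊗ₜ[K] ((u ^ j : Bˣ) : B) -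
            ((u ^ j : Bˣ) : B) ⊗ₜ[K] ((u ^ i : Bˣ) : B)) * ρ (X ⊗ₜ[K] 1) := by
  subst hu
  obtain ⟨H, hH⟩ := twisted_subgroup_aux
    ((Algebra.TensorProduct.comm K B B : B ⊗[K] B →* B ⊗[K] B)) ρ
    ((u : B) ⊗ₜ[K] 1 - (1 : B) ⊗ₜ[K] (u : B)) (ρ ((u : B) ⊗ₜ[K] 1)) hLeib
  let a : (B ⊗[K] B)ˣ :=
    Units.map (Algebra.TensorProduct.includeLeft : B →ₐ[K] B ⊗[K] B).toMonoidHom u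
  let b : (B ⊗[K] B)ˣ :=
    Units.map (Algebra.TensorProduct.includeRight : B →ₐ[K] B ⊗[K] B).toMonoidHom u
  have hab : Commute ((u : B) ⊗ₜ[K] (1 : B)) ((1 : B) ⊗ₜ[K] (u : B)) := by
    simp [Commute, SemiconjBy]
  have hneg : ρ ((1 : B) ⊗ₜ[K] (u : B)) = - ρ ((u : B) ⊗ₜ[K] 1) := by
    have e1 := hLeib ((u : B) ⊗ₜ[K] (1 : B)) ((1 : B) ⊗ₜ[K] (u : B))
    have e2 := hLeib ((1 : B) ⊗ₜ[K] (u : B)) ((u : B) ⊗ₜ[K] (1 : B))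
    rw [← hab.eq, e1, TensorProduct.comm_tmul, TensorProduct.comm_tmul, hc2.eq, hc3.eq] at e2
    refine eq_neg_of_add_eq_zero_left (hregL _ ?_)
    rw [sub_mul, mul_add, mul_add, ← mul_add, ← mul_add, sub_eq_zero]
    rw [mul_add, mul_add, e2, add_comm]
  have ha : a ∈ H := by
    rw [hH]
    refine ⟨?_, ?_, ?_⟩
    · change ρ ((u : B) ⊗ₜ[K] 1) * _ = ((u : B) ⊗ₜ[K] 1 - (1 : B) ⊗ₜ[K] (u : B)) * _
      exact (hc1.sub_right hc2).eq
    · exact (Commute.refl _).sub_right hab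
    · exact hc1.symm
  have hb : b ∈ H := by
    rw [hH]
    refine ⟨?_, ?_, ?_⟩
    · change ρ ((1 : B) ⊗ₜ[K] (u : B)) * _ = ((1 : B) ⊗ₜ[K] (u : B) - (u : B) ⊗ₜ[K] 1) * _
      rw [hneg, neg_mul, (hc1.sub_right hc2).eq, ← neg_mul, neg_sub]
    · exact hab.symm.sub_right (Commute.refl _)
    · exact hc2.symm
  intro i j
  have h := ((hH _).1 (H.mul_mem (H.zpow_mem ha i) (H.zpow_mem hb j))).1
  have key : ((a ^ i * b ^ j : (B ⊗[K] B)ˣ) : B ⊗[K] B) =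
      ((u ^ i : Bˣ) : B) ⊗ₜ[K] ((u ^ j : Bˣ) : B) := by
    simp only [a, b, ← map_zpow, Units.val_mul, Units.coe_map]
    simp
  rw [key] at h
  exact h
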